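/- (Instability for three or more directions) Let 𝒮 be a set of m ≥ 3 1-dimensional linear subspaces of ℝ^d, and let α ∈ ℕ. Then there exist finite sets F₁, F₂ ⊆ ℝ^d such that: (i) F₁ is uniquely determined among finite subsets of ℝ^d by its X-rays parallel to the lines of 𝒮; (ii) F₂ is likewise uniquely determined; (iii) Δ_𝒮(F₁, F₂) = 2(m − 1); (iv) |F₁| = |F₂| ≥ α; (v) F₁ ∩ F₂ = ∅. The statement also holds with ℝ^d replaced by ℤ^d and 𝒮 a set of m ≥ 3 lattice lines. -/

import Mathlib

open Set

variable {d : ℕ}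

/-- The affine line through the coset `T` of the modulo-`S` quotient, i.e. an affine
line parallel to `S` when `S` is 1-dimensional. -/
def fiber (S : Submodule ℝ (Fin d → ℝ)) (T : (Fin d → ℝ) ⧸ S) : Set (Fin d → ℝ) :=
  {x | (Submodule.Quotient.mk x : (Fin d → ℝ) ⧸ S) = T}

/-- `F₁` and `F₂` have the same (discrete) X-ray parallel to `S`. -/
def XrayEq (S : Submodule ℝ (Fin d → ℝ)) (F₁ F₂ : Set (Fin d → ℝ)) : Prop :=
  ∀ T : (Fin d → ℝ) ⧸ S, (F₁ ∩ fiber S T).ncard = (F₂ ∩ fiber S T).ncard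

/-- `F₁` and `F₂` are tomographically equivalent w.r.t. the family `𝒮` of lines. -/
def TomEq (𝒮 : Set (Submodule ℝ (Fin d → ℝ))) (F₁ F₂ : Set (Fin d → ℝ)) : Prop :=
  ∀ S ∈ 𝒮, XrayEq S F₁ F₂

/-- A lattice line: a line through the origin spanned by a nonzero integer vector. -/
def IsLatticeLine (S : Submodule ℝ (Fin d → ℝ)) : Prop :=
  ∃ v : Fin d → ℤ, v ≠ 0 ∧ S = Submodule.span ℝ {fun i => (v i : ℝ)}

/-- The canonical embedding of `ℤ^d` into `ℝ^d`. -/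
def embed (x : Fin d → ℤ) : Fin d → ℝ := fun i => (x i : ℝ)

/-- The X-ray difference `Δ_𝒮(F₁,F₂)`. -/
noncomputable def xrayDiff (𝒮 : Set (Submodule ℝ (Fin d → ℝ))) (F₁ F₂ : Set (Fin d → ℝ)) : ℕ :=
  ∑ᶠ S ∈ 𝒮, ∑ᶠ T : (Fin d → ℝ) ⧸ S,
    (((F₁ ∩ fiber S T).ncard : ℤ) - ((F₂ ∩ fiber S T).ncard : ℤ)).natAbs

/-- A convex lattice set: `F = conv(F) ∩ ℤ^d`. -/
def IsConvexLatticeSet (F : Finset (Fin d → ℤ)) : Prop :=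
  embed '' ↑F = convexHull ℝ (embed '' ↑F) ∩ Set.range (embed : (Fin d → ℤ) → (Fin d → ℝ))



namespace Instab

/-- The point with formal coefficient set `A`. -/
noncomputable def Pt {N ι : Type} (t : N → ℤ) (col : N → ι) (v : ι → Fin d → ℝ)
    (A : Finset N) : Fin d → ℝ :=
  ∑ y ∈ A, (t y : ℝ) • v (col y)

/-- Rational parameters for which the lines given by `A` are concurrent. -/
def WW {N ι : Type} (col : N → ι) (v : ι → Fin d → ℝ) (A : ι → Finset N) :
    Submodule ℚ (N → ℚ) where
  carrier := {t | ∃ x : Fin d → ℝ, ∀ k,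
    x - ∑ y ∈ A k, (t y : ℝ) • v (col y) ∈ Submodule.span ℝ {v k}}
  add_mem' := by
    rintro a b ⟨x, hx⟩ ⟨y, hy⟩
    refine ⟨x + y, fun k => ?_⟩
    have := Submodule.add_mem _ (hx k) (hy k)
    convert this using 1
    simp only [Pi.add_apply, Rat.cast_add, add_smul, Finset.sum_add_distrib]
    abel
  zero_mem' := ⟨0, fun k => by simp⟩
  smul_mem' := by
    rintro c a ⟨x, hx⟩
    refine ⟨(c : ℝ) • x, fun k => ?_⟩
    have := Submodule.smul_mem _ (c : ℝ) (hx k)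
    convert this using 1
    simp only [Pi.smul_apply, smul_eq_mul, Rat.cast_mul, mul_smul, smul_sub, Finset.smul_sum]

lemma WW_top {N ι : Type} [DecidableEq N] (col : N → ι) (v : ι → Fin d → ℝ)
    (hv : ∀ i k, i ≠ k → v i ∉ Submodule.span ℝ {v k}) (A : ι → Finset N)
    (h : WW col v A = ⊤) (y : N) (k k' : ι) (hk : k ≠ col y) (hk' : k' ≠ col y) :
    y ∈ A k ↔ y ∈ A k' := by
  have hm : (Pi.single y 1 : N → ℚ) ∈ WW col v A := by rw [h]; trivial
  obtain ⟨x, hx⟩ := hm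
  have hs : ∀ k, ∑ z ∈ A k, (((Pi.single y 1 : N → ℚ) z : ℚ) : ℝ) • v (col z) =
      (if y ∈ A k then (1 : ℝ) else 0) • v (col y) := by
    intro k
    split_ifs with hy
    · rw [Finset.sum_eq_single_of_mem y hy]
      · simp
      · intro b _ hb
        simp [Pi.single_eq_of_ne hb]
    · rw [zero_smul]
      apply Finset.sum_eq_zero
      intro z hz
      have : z ≠ y := fun e => hy (e ▸ hz)
      simp [Pi.single_eq_of_ne this]
  have hxc := hx (col y)
  rw [hs] at hxc
  have hxm : x ∈ Submodule.span ℝ {v (col y)} := by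
    have := Submodule.add_mem _ hxc
      (Submodule.smul_mem _ (if y ∈ A (col y) then (1 : ℝ) else 0)
        (Submodule.mem_span_singleton_self (v (col y))))
    simpa using this
  obtain ⟨l, rfl⟩ := Submodule.mem_span_singleton.1 hxm
  have key : ∀ k, k ≠ col y → l = if y ∈ A k then (1 : ℝ) else 0 := by
    intro k hk
    by_contra hne
    have h1 := hx k
    rw [hs, ← sub_smul] at h1
    have h2 := Submodule.smul_mem _ (l - if y ∈ A k then (1 : ℝ) else 0)⁻¹ h1
    rw [smul_smul, inv_mul_cancel₀ (sub_ne_zero.2 hne), one_smul] at h2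
    exact hv _ _ (Ne.symm hk) h2
  have h1 := key k hk
  have h2 := key k' hk'
  rw [h1] at h2
  by_cases ha : y ∈ A k <;> by_cases hb : y ∈ A k' <;> simp_all

lemma gen {N ι : Type} [Fintype N] [DecidableEq N] [Fintype ι] [DecidableEq ι]
    (col : N → ι) (v : ι → Fin d → ℝ)
    (hv : ∀ i k, i ≠ k → v i ∉ Submodule.span ℝ {v k}) :
    ∃ t : N → ℤ, ∀ (A : ι → Finset N) (x : Fin d → ℝ),
      (∀ k, x - Pt t col v (A k) ∈ Submodule.span ℝ {v k}) →
      ∀ y k k', k ≠ col y → k' ≠ col y → (y ∈ A k ↔ y ∈ A k') := by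
  classical
  let s : Finset (Submodule ℚ (N → ℚ)) :=
    (Finset.univ.image (fun A : ι → Finset N => WW col v A)).filter (· ≠ ⊤)
  have hs : (⊤ : Submodule ℚ (N → ℚ)) ∉ s := by simp [s]
  have hne := Subspace.biUnion_ne_univ_of_top_notMem hs
  obtain ⟨t, ht⟩ := (Set.ne_univ_iff_exists_notMem _).1 hne
  obtain ⟨D, hD⟩ := IsLocalization.exist_integer_multiples_of_finite (nonZeroDivisors ℤ) t
  choose t' ht' using hD
  have hD0 : (((D : ℤ) : ℚ)) ≠ 0 := by
    exact_mod_cast nonZeroDivisors.ne_zero D.2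
  refine ⟨t', fun A x hx y k k' hk hk' => ?_⟩
  by_cases hW : WW col v A = ⊤
  · exact WW_top col v hv A hW y k k' hk hk'
  · exfalso
    apply ht
    have hmem : WW col v A ∈ s := by simp [s, hW]
    refine Set.mem_biUnion (show WW col v A ∈ (s : Set _) from hmem) ?_
    have h1 : (fun y => (t' y : ℚ)) ∈ WW col v A := by
      refine ⟨x, fun k => ?_⟩
      have := hx k
      simpa [Pt] using this
    have h2 := Submodule.smul_mem _ (((D : ℤ) : ℚ)⁻¹) h1
    have h3 : t = (((D : ℤ) : ℚ)⁻¹) • (fun y => (t' y : ℚ)) := by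
     ext y
     have := ht' y
     simp only [algebraMap_int_eq, eq_intCast] at this
     simp only [Pi.smul_apply, smul_eq_mul, this]
     rw [zsmul_eq_mul]
     field_simp
    rw [h3]
    exact h2

lemma Pt_sub {N ι : Type} [DecidableEq N] (t : N → ℤ) (col : N → ι) (v : ι → Fin d → ℝ)
    (A B : Finset N) (k : ι) (h : ∀ y, col y ≠ k → (y ∈ A ↔ y ∈ B)) :
    Pt t col v A - Pt t col v B ∈ Submodule.span ℝ {v k} := by
  have hA : Pt t col v A = ∑ y ∈ A ∪ B, if y ∈ A then (t y : ℝ) • v (col y) else 0 := by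
    rw [← Finset.sum_filter]; unfold Pt; congr 1; ext y; simp
  have hB : Pt t col v B = ∑ y ∈ A ∪ B, if y ∈ B then (t y : ℝ) • v (col y) else 0 := by
    rw [← Finset.sum_filter]; unfold Pt; congr 1; ext y; simp
  rw [hA, hB, ← Finset.sum_sub_distrib]
  apply Submodule.sum_mem
  intro y _
  by_cases hy : col y = k
  · subst hy
    have := Submodule.smul_mem _ (t y : ℝ) (Submodule.mem_span_singleton_self (R := ℝ) (v (col y)))
    by_cases h1 : y ∈ A <;> by_cases h2 : y ∈ B <;> simp [h1, h2, this]
  · have := h y hy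
    by_cases h1 : y ∈ A <;> simp_all

/-- Formal coefficient set of the point with index `(j, a, I)`. -/
def AA {ι : Type} [Fintype ι] [DecidableEq ι] (n : ℕ) (o : ι) (j a : ℕ) (I : Finset ι) :
    Finset (Fin (n + 1) × ι) :=
  Finset.univ.filter (fun y => (y.2 = o ∧ y.1.val = a) ∨ (y.2 ∈ I ∧ y.1.val = j))

/-- valid index -/
def Val {ι : Type} (n : ℕ) (o : ι) (j a : ℕ) (I : Finset ι) : Prop :=
  j < n ∧ (a = j ∨ a = j + 1) ∧ o ∉ I ∧ I.Nonempty

/-- The combinatorial properties of a generic configuration of points. -/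
structure Conf {ι : Type} [DecidableEq ι] (n : ℕ) (o : ι) (v : ι → Fin d → ℝ)
    (p : ℕ → ℕ → Finset ι → Fin d → ℝ) : Prop where
  lo : ∀ j a I j' a' I', Val n o j a I → Val n o j' a' I' →
    p j a I - p j' a' I' ∈ Submodule.span ℝ {v o} → j = j' ∧ I = I'
  lo' : ∀ j a a' I, o ∉ I → p j a I - p j a' I ∈ Submodule.span ℝ {v o}
  lk : ∀ k, k ≠ o → ∀ j a I j' a' I', j ≤ n → a ≤ n → o ∉ I → j' ≤ n → a' ≤ n → o ∉ I' →
    p j a I - p j' a' I' ∈ Submodule.span ℝ {v k} →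
    a = a' ∧ I.erase k = I'.erase k ∧ (j = j' ∨ I.erase k = ∅)
  lk' : ∀ k, k ≠ o → ∀ j a I j' I', o ∉ I → o ∉ I' → I.erase k = I'.erase k →
    (j = j' ∨ I.erase k = ∅) → p j a I - p j' a I' ∈ Submodule.span ℝ {v k}
  grid : ∀ x, (∀ k, ∃ j a I, Val n o j a I ∧ x - p j a I ∈ Submodule.span ℝ {v k}) →
    ∃ j a I, Val n o j a I ∧ x = p j a I

lemma exists_conf {ι : Type} [Fintype ι] [DecidableEq ι] (hι : 3 ≤ Fintype.card ι)
    (n : ℕ) (o : ι) (v : ι → Fin d → ℝ)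
    (hv : ∀ i k, i ≠ k → v i ∉ Submodule.span ℝ {v k}) :
    ∃ t : Fin (n + 1) × ι → ℤ, Conf n o v (fun j a I => Pt t Prod.snd v (AA n o j a I)) := by
  obtain ⟨t, ht⟩ := gen (N := Fin (n + 1) × ι) Prod.snd v hv
  refine ⟨t, ?_⟩
  have third : ∀ a b : ι, ∃ c, c ≠ a ∧ c ≠ b := by
    intro a b
    have : ∃ c, c ∉ ({a, b} : Finset ι) := by
      by_contra hcon
      push Not at hcon
      have h1 : Finset.univ ⊆ ({a, b} : Finset ι) := fun c _ => hcon c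
      have h2 := Finset.card_le_card h1
      have h3 := Finset.card_le_two (a := a) (b := b)
      rw [Finset.card_univ] at h2
      omega
    obtain ⟨c, hc⟩ := this
    simp at hc
    exact ⟨c, hc.1, hc.2⟩
  have same : ∀ (A B : Finset (Fin (n + 1) × ι)) (k : ι),
      Pt t Prod.snd v A - Pt t Prod.snd v B ∈ Submodule.span ℝ {v k} →
      ∀ y, y.2 ≠ k → (y ∈ A ↔ y ∈ B) := by
    intro A B k h y hy
    obtain ⟨k', h1, h2⟩ := third k y.2
    have := ht (fun i => if i = k then A else B) (Pt t Prod.snd v B) (by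
      intro i
      by_cases hi : i = k
      · subst hi
        have := Submodule.neg_mem _ h
        simpa using this
      · simp [hi]) y k k' (Ne.symm hy) h2
    simpa [h1] using this
  have inj : ∀ i k, i ≠ k → ∀ x : Fin d → ℝ, x ∈ Submodule.span ℝ {v i} →
      x ∈ Submodule.span ℝ {v k} → x = 0 := by
    intro i k hik x h1 h2
    obtain ⟨l, rfl⟩ := Submodule.mem_span_singleton.1 h1
    by_contra hne
    have hl : l ≠ 0 := by rintro rfl; simp at hne
    have := Submodule.smul_mem _ l⁻¹ h2
    rw [smul_smul, inv_mul_cancel₀ hl, one_smul] at this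
    exact hv i k hik this
  refine ⟨?_, ?_, ?_, ?_, ?_⟩
  · intro j a I j' a' I' h h' hp
    have hs := same _ _ _ hp
    simp only [AA, Finset.mem_filter, Finset.mem_univ, true_and, Prod.forall] at hs
    obtain ⟨hj, ha, hoI, i, hi⟩ := h
    obtain ⟨hj', ha', hoI', i', hi'⟩ := h'
    have hio : i ≠ o := fun e => hoI (e ▸ hi)
    have h1 := hs ⟨j, by omega⟩ i hio
    simp only [hio, hi, false_and, true_and, false_or, true_iff] at h1
    obtain ⟨h1, rfl⟩ := h1
    refine ⟨rfl, ?_⟩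
    ext c
    by_cases hc : c = o
    · subst hc; simp [hoI, hoI']
    · have := hs ⟨j, by omega⟩ c hc
      simpa [hc] using this
  · intro j a a' I hI
    apply Pt_sub
    intro y hy
    simp [AA, hy]
  · intro k hk j a I j' a' I' hj ha hoI hj' ha' hoI' hp
    have hs := same _ _ _ hp
    simp only [AA, Finset.mem_filter, Finset.mem_univ, true_and, Prod.forall] at hs
    have haa : a = a' := by
      have h1 := hs ⟨a, by omega⟩ o (Ne.symm hk)
      simpa [hoI, hoI'] using h1
    have key : ∀ c, c ≠ o → c ≠ k → c ∈ I → c ∈ I' ∧ j = j' := by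
      intro c hc hck hcI
      have h1 := hs ⟨j, by omega⟩ c hck
      simpa [hc, hcI] using h1
    have key' : ∀ c, c ≠ o → c ≠ k → c ∈ I' → c ∈ I ∧ j' = j := by
      intro c hc hck hcI
      have h1 := hs ⟨j', by omega⟩ c hck
      simpa [hc, hcI] using h1
    refine ⟨haa, ?_, ?_⟩
    · ext c
      simp only [Finset.mem_erase]
      constructor
      · rintro ⟨h1, h2⟩
        exact ⟨h1, (key c (fun e => hoI (e ▸ h2)) h1 h2).1⟩
      · rintro ⟨h1, h2⟩
        exact ⟨h1, (key' c (fun e => hoI' (e ▸ h2)) h1 h2).1⟩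
    · by_cases he : I.erase k = ∅
      · exact Or.inr he
      · left
        obtain ⟨c, hc⟩ := Finset.nonempty_iff_ne_empty.2 he
        rw [Finset.mem_erase] at hc
        exact (key c (fun e => hoI (e ▸ hc.2)) hc.1 hc.2).2
  · intro k hk j a I j' I' hoI hoI' he hj
    apply Pt_sub
    intro y hy
    have h1 : y.2 ∈ I ↔ y.2 ∈ I' := by
      have : y.2 ∈ I.erase k ↔ y.2 ∈ I'.erase k := by rw [he]
      simpa [hy] using this
    rcases hj with rfl | hj
    · simp [AA, h1]
    · have h2 : y.2 ∉ I := by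
        intro h
        have : y.2 ∈ I.erase k := Finset.mem_erase.2 ⟨hy, h⟩
        simp [hj] at this
      have h3 : y.2 ∉ I' := fun h => h2 (h1.2 h)
      simp [AA, h2, h3]
  · intro x hx
    choose j a I hval hmem using hx
    have hc := ht (fun k => AA n o (j k) (a k) (I k)) x hmem
    obtain ⟨hj, ha, hoI, i, hi⟩ := hval o
    have hio : i ≠ o := fun e => hoI (e ▸ hi)
    obtain ⟨k, hko, hki⟩ := third o i
    obtain ⟨hjk, hak, hoIk, -⟩ := hval k
    have h1 : j o = j k := by
      have := hc (⟨j o, by omega⟩, i) o k (Ne.symm hio) hki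
      simp [AA, hio, hi] at this
      exact this.2
    refine ⟨j o, a k, I o, ⟨hj, by rw [h1]; exact hak, hoI, ⟨i, hi⟩⟩, ?_⟩
    rw [← sub_eq_zero]
    apply inj o k (Ne.symm hko)
    · have h2 := Pt_sub t Prod.snd v (AA n o (j o) (a o) (I o)) (AA n o (j o) (a k) (I o)) o
        (by intro y hy; simp [AA, hy])
      have := Submodule.add_mem _ (hmem o) h2
      simpa using this
    · have h2 := Pt_sub t Prod.snd v (AA n o (j k) (a k) (I k)) (AA n o (j o) (a k) (I o)) k
        (by
          intro y hy
          by_cases hyo : y.2 = o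
          · simp [AA, hyo, hoI, hoIk]
          · have := hc y k o (Ne.symm hy) (Ne.symm hyo)
            simp only [AA, Finset.mem_filter, Finset.mem_univ, true_and, hyo, false_and,
              false_or] at this ⊢
            exact this)
      have := Submodule.add_mem _ (hmem k) h2
      simpa using this

lemma mem_fiber_iff (S : Submodule ℝ (Fin d → ℝ)) (x y : Fin d → ℝ) :
    y ∈ fiber S (Submodule.Quotient.mk x) ↔ y - x ∈ S := by
  simp [fiber, Submodule.Quotient.eq]

lemma peel1 (S : Submodule ℝ (Fin d → ℝ)) (F G : Set (Fin d → ℝ)) (hF : F.Finite)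
    (h : XrayEq S F G) (x : Fin d → ℝ)
    (hy : ∀ y ∈ G, y ≠ x → y - x ∈ S → y ∈ F) (hx : x ∈ F) : x ∈ G := by
  by_contra hxG
  have hT := h (Submodule.Quotient.mk x)
  have hlt : (G ∩ fiber S (Submodule.Quotient.mk x)).ncard <
      (F ∩ fiber S (Submodule.Quotient.mk x)).ncard := by
    apply Set.ncard_lt_ncard _ (hF.subset Set.inter_subset_left)
    refine ⟨?_, ?_⟩
    · rintro y ⟨h1, h2⟩
      exact ⟨hy y h1 (fun e => hxG (e ▸ h1)) ((mem_fiber_iff S x y).1 h2), h2⟩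
    · intro hsub
      have := hsub (a := x) ⟨hx, by rw [mem_fiber_iff]; simp⟩
      exact hxG this.1
  omega

lemma peel (S : Submodule ℝ (Fin d → ℝ)) (F G : Set (Fin d → ℝ)) (hF : F.Finite)
    (hG : G.Finite) (h : XrayEq S F G) (x : Fin d → ℝ)
    (hy : ∀ y, (y ∈ F ∨ y ∈ G) → y ≠ x → y - x ∈ S → (y ∈ F ↔ y ∈ G)) : x ∈ F ↔ x ∈ G :=
  ⟨peel1 S F G hF h x (fun y h1 h2 h3 => (hy y (Or.inr h1) h2 h3).2 h1),
   peel1 S G F hG (fun T => (h T).symm) x (fun y h1 h2 h3 => (hy y (Or.inl h1) h2 h3).1 h1)⟩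

lemma uniq {ι : Type} [DecidableEq ι] (n : ℕ) (o : ι) (v : ι → Fin d → ℝ)
    (p : ℕ → ℕ → Finset ι → Fin d → ℝ) (C : Conf n o v p) (F G : Set (Fin d → ℝ))
    (hF : F.Finite) (hG : G.Finite) (hGX : ∀ x ∈ G, ∃ j a I, Val n o j a I ∧ x = p j a I)
    (h : ∀ k, XrayEq (Submodule.span ℝ {v k}) F G) : F = G := by
  have hFX : ∀ x ∈ F, ∃ j a I, Val n o j a I ∧ x = p j a I := by
    intro x hx
    apply C.grid
    intro k
    have hT := h k (Submodule.Quotient.mk x)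
    have hpos : 0 < (F ∩ fiber (Submodule.span ℝ {v k}) (Submodule.Quotient.mk x)).ncard := by
      rw [Set.ncard_pos (hF.subset Set.inter_subset_left)]
      exact ⟨x, hx, by rw [mem_fiber_iff]; simp⟩
    rw [hT, Set.ncard_pos (hG.subset Set.inter_subset_left)] at hpos
    obtain ⟨y, hy, hy'⟩ := hpos
    obtain ⟨j, a, I, hv, rfl⟩ := hGX y hy
    refine ⟨j, a, I, hv, ?_⟩
    rw [mem_fiber_iff] at hy'
    have := Submodule.neg_mem _ hy'
    simpa using this
  have hX : ∀ x, (x ∈ F ∨ x ∈ G) → ∃ j a I, Val n o j a I ∧ x = p j a I := by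
    rintro x (hx | hx)
    · exact hFX x hx
    · exact hGX x hx
  -- singletons
  have stepO : ∀ j I, Val n o j j I → (p j j I ∈ F ↔ p j j I ∈ G) →
      (p j (j + 1) I ∈ F ↔ p j (j + 1) I ∈ G) := by
    intro j I hval hag
    have hval' : Val n o j (j + 1) I := ⟨hval.1, Or.inr rfl, hval.2.2⟩
    apply peel _ F G hF hG (h o)
    intro y hy hne hmem
    obtain ⟨j', a', I', hv, rfl⟩ := hX y hy
    obtain ⟨rfl, rfl⟩ := C.lo _ _ _ _ _ _ hv hval' hmem
    rcases hv.2.1 with rfl | rfl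
    · exact hag
    · exact absurd rfl hne
  have step1 : ∀ k, k ≠ o → ∀ j, j < n → (p j j {k} ∈ F ↔ p j j {k} ∈ G) := by
    intro k hk j
    induction j with
    | zero =>
      intro hj
      apply peel _ F G hF hG (h k)
      intro y hy hne hmem
      obtain ⟨j', a', I', hv, rfl⟩ := hX y hy
      have hok : o ∉ ({k} : Finset ι) := by simpa using Ne.symm hk
      obtain ⟨hv1, hv2, hv3, hv4⟩ := hv
      obtain ⟨h1, h2, h3⟩ := C.lk k hk _ _ _ _ _ _ hv1.le (by omega) hv3 (by omega) (by omega)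
        hok hmem
      have hI' : I' = {k} := by
        have : I'.erase k = ∅ := by rw [h2]; simp
        rcases (Finset.erase_eq_empty_iff _ _).1 this with h | h
        · exact absurd h hv4.ne_empty
        · exact h
      have hj' : j' = 0 := by omega
      subst hI' hj' h1
      exact absurd rfl hne
    | succ j ih =>
      intro hj
      have hok : o ∉ ({k} : Finset ι) := by simpa using Ne.symm hk
      have ih' := stepO j {k} ⟨by omega, Or.inl rfl, hok, by simp⟩ (ih (by omega))
      apply peel _ F G hF hG (h k)
      intro y hy hne hmem
      obtain ⟨j', a', I', hv, rfl⟩ := hX y hy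
      obtain ⟨hv1, hv2, hv3, hv4⟩ := hv
      obtain ⟨h1, h2, h3⟩ := C.lk k hk _ _ _ _ _ _ hv1.le (by omega) hv3 (by omega) (by omega)
        hok hmem
      have hI' : I' = {k} := by
        have : I'.erase k = ∅ := by rw [h2]; simp
        rcases (Finset.erase_eq_empty_iff _ _).1 this with h | h
        · exact absurd h hv4.ne_empty
        · exact h
      subst hI' h1
      rcases hv2 with hv2 | hv2
      · subst hv2
        exact absurd rfl hne
      · have : j' = j := by omega
        subst this
        exact ih'
  have step1' : ∀ k, ∀ j a, Val n o j a {k} → (p j a {k} ∈ F ↔ p j a {k} ∈ G) := by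
    intro k j a hv
    have hk : k ≠ o := by
      have := hv.2.2.1
      simpa using Ne.symm (by simpa using this : o ≠ k)
    have hs := step1 k hk j hv.1
    rcases hv.2.1 with rfl | rfl
    · exact hs
    · exact stepO j {k} ⟨hv.1, Or.inl rfl, hv.2.2⟩ hs
  have step2 : ∀ I : Finset ι, ∀ j a, Val n o j a I → (p j a I ∈ F ↔ p j a I ∈ G) := by
    intro I
    induction I using Finset.strongInduction with
    | H I ih =>
      intro j a hv
      obtain ⟨k, hkI⟩ := hv.2.2.2
      have hk : k ≠ o := fun e => hv.2.2.1 (e ▸ hkI)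
      by_cases he : I.erase k = ∅
      · rcases (Finset.erase_eq_empty_iff _ _).1 he with h | h
        · exact absurd h hv.2.2.2.ne_empty
        · subst h
          exact step1' k j a hv
      · apply peel _ F G hF hG (h k)
        intro y hy hne hmem
        obtain ⟨j', a', I', hv', rfl⟩ := hX y hy
        obtain ⟨hv1, hv2, hv3, hv4⟩ := hv'
        have hva := hv.1
        have hvb := hv.2.1
        obtain ⟨h1, h2, h3⟩ := C.lk k hk _ _ _ _ _ _ hv1.le (by omega) hv3 (by omega) (by omega)
          hv.2.2.1 hmem
        rw [h2] at h3
        have hj : j' = j := h3.resolve_right he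
        subst hj h1
        by_cases hkI' : k ∈ I'
        · have : I' = I := by
            rw [← Finset.insert_erase hkI', h2, Finset.insert_erase hkI]
          subst this
          exact absurd rfl hne
        · rw [Finset.erase_eq_of_notMem hkI'] at h2
          subst h2
          exact ih _ (Finset.erase_ssubset hkI) _ _ ⟨hv1, hv2, hv3, hv4⟩
  ext x
  constructor
  · intro hx
    obtain ⟨j, a, I, hv, rfl⟩ := hFX x hx
    exact (step2 I j a hv).1 hx
  · intro hx
    obtain ⟨j, a, I, hv, rfl⟩ := hGX x hx
    exact (step2 I j a hv).2 hx

/-- Nonempty sets of directions other than `o`. -/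
def KK {ι : Type} [Fintype ι] [DecidableEq ι] (o : ι) : Finset (Finset ι) :=
  (Finset.univ.filter (fun I => o ∉ I ∧ I.Nonempty))

/-- Indices. -/
def JJ {ι : Type} [Fintype ι] [DecidableEq ι] (n : ℕ) (o : ι) : Finset (ℕ × Finset ι) :=
  Finset.range n ×ˢ KK o

/-- Points of parity `e`. -/
def qq {ι : Type} (p : ℕ → ℕ → Finset ι → Fin d → ℝ) (e : ℕ) (y : ℕ × Finset ι) : Fin d → ℝ :=
  p y.1 (y.1 + (y.2.card + e) % 2) y.2

lemma val_of_mem {ι : Type} [Fintype ι] [DecidableEq ι] (n : ℕ) (o : ι) (e : ℕ)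
    (y : ℕ × Finset ι) (hy : y ∈ JJ n o) : Val n o y.1 (y.1 + (y.2.card + e) % 2) y.2 := by
  simp only [JJ, KK, Finset.mem_product, Finset.mem_range, Finset.mem_filter, Finset.mem_univ,
    true_and] at hy
  exact ⟨hy.1, by omega, hy.2⟩

lemma qq_inj {ι : Type} [Fintype ι] [DecidableEq ι] (n : ℕ) (o : ι) (v : ι → Fin d → ℝ)
    (p : ℕ → ℕ → Finset ι → Fin d → ℝ) (C : Conf n o v p) (e : ℕ) :
    Set.InjOn (qq p e) (JJ n o) := by
  intro y hy z hz h
  have := C.lo _ _ _ _ _ _ (val_of_mem n o e y hy) (val_of_mem n o e z hz) (by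
    change qq p e y - qq p e z ∈ _
    rw [h]; simp)
  exact Prod.ext this.1 this.2

lemma qq_ne {ι : Type} [Fintype ι] [DecidableEq ι] (n : ℕ) (o k : ι) (hk : k ≠ o)
    (v : ι → Fin d → ℝ)
    (p : ℕ → ℕ → Finset ι → Fin d → ℝ) (C : Conf n o v p) (y z : ℕ × Finset ι)
    (hy : y ∈ JJ n o) (hz : z ∈ JJ n o) : qq p 0 y ≠ qq p 1 z := by
  intro h
  have h1 := val_of_mem n o 0 y hy
  have h2 := val_of_mem n o 1 z hz
  have := C.lo _ _ _ _ _ _ h1 h2 (by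
    change qq p 0 y - qq p 1 z ∈ _
    rw [h]; simp)
  have h3 := C.lk k hk y.1 (y.1 + (y.2.card + 0) % 2) y.2 z.1 (z.1 + (z.2.card + 1) % 2) z.2 h1.1.le (by have := h1.1; omega) h1.2.2.1
    h2.1.le (by have := h2.1; omega) h2.2.2.1 (by
    change qq p 0 y - qq p 1 z ∈ _
    rw [h]; simp)
  obtain ⟨ha, hb⟩ := this
  have hc := h3.1
  rw [ha, hb] at hc
  omega

open Classical in
lemma count {ι : Type} [Fintype ι] [DecidableEq ι] (n : ℕ) (o : ι) (v : ι → Fin d → ℝ)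
    (p : ℕ → ℕ → Finset ι → Fin d → ℝ) (C : Conf n o v p) (e : ℕ)
    (S : Submodule ℝ (Fin d → ℝ)) (T : (Fin d → ℝ) ⧸ S) :
    ((qq p e '' (JJ n o : Set (ℕ × Finset ι))) ∩ fiber S T).ncard =
      ∑ j ∈ Finset.range n, ∑ I ∈ KK o,
        if (Submodule.Quotient.mk (qq p e (j, I)) : (Fin d → ℝ) ⧸ S) = T then 1 else 0 := by
  rw [← Finset.sum_product (f := fun y : ℕ × Finset ι =>
    if (Submodule.Quotient.mk (qq p e y) : (Fin d → ℝ) ⧸ S) = T then 1 else 0)]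
  rw [← Finset.card_filter]
  have : (qq p e '' (JJ n o : Set (ℕ × Finset ι))) ∩ fiber S T =
      qq p e '' (((Finset.range n ×ˢ KK o).filter (fun y =>
        (Submodule.Quotient.mk (qq p e y) : (Fin d → ℝ) ⧸ S) = T) : Finset _) :
          Set (ℕ × Finset ι)) := by
    ext x
    constructor
    · rintro ⟨⟨y, hy, rfl⟩, h2⟩
      exact ⟨y, by rw [Finset.mem_coe, Finset.mem_filter]; exact ⟨hy, h2⟩, rfl⟩
    · rintro ⟨y, hy, rfl⟩
      rw [Finset.mem_coe, Finset.mem_filter] at hy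
      exact ⟨⟨y, hy.1, rfl⟩, hy.2⟩
  rw [this, Set.InjOn.ncard_image, Set.ncard_coe_finset]
  apply (qq_inj n o v p C e).mono
  intro y hy
  rw [Finset.mem_coe, Finset.mem_filter] at hy
  exact hy.1

open Classical in
lemma diff_o {ι : Type} [Fintype ι] [DecidableEq ι] (n : ℕ) (o : ι) (v : ι → Fin d → ℝ)
    (p : ℕ → ℕ → Finset ι → Fin d → ℝ) (C : Conf n o v p)
    (T : (Fin d → ℝ) ⧸ (Submodule.span ℝ {v o})) :
    ((qq p 0 '' (JJ n o : Set (ℕ × Finset ι))) ∩ fiber _ T).ncard =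
    ((qq p 1 '' (JJ n o : Set (ℕ × Finset ι))) ∩ fiber _ T).ncard := by
  rw [count n o v p C, count n o v p C]
  refine Finset.sum_congr rfl fun j _ => Finset.sum_congr rfl fun I hI => ?_
  have : (Submodule.Quotient.mk (qq p 0 (j, I)) : (Fin d → ℝ) ⧸ (Submodule.span ℝ {v o})) =
      Submodule.Quotient.mk (qq p 1 (j, I)) := by
    rw [Submodule.Quotient.eq]
    simp only [KK, Finset.mem_filter] at hI
    exact C.lo' _ _ _ _ hI.2.1
  rw [this]

/-- toggle membership of `k` -/
def tog {ι : Type} [DecidableEq ι] (k : ι) (I : Finset ι) : Finset ι :=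
  if k ∈ I then I.erase k else insert k I

lemma tog_tog {ι : Type} [DecidableEq ι] (k : ι) (I : Finset ι) : tog k (tog k I) = I := by
  by_cases h : k ∈ I <;> simp [tog, h]

lemma tog_erase {ι : Type} [DecidableEq ι] (k : ι) (I : Finset ι) :
    (tog k I).erase k = I.erase k := by
  by_cases h : k ∈ I <;> simp [tog, h]

lemma tog_card {ι : Type} [DecidableEq ι] (k : ι) (I : Finset ι) :
    ((tog k I).card + 1) % 2 = I.card % 2 := by
  by_cases h : k ∈ I
  · have := Finset.card_erase_add_one h
    simp only [tog, h, if_true]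
    omega
  · simp only [tog, h, if_false, Finset.card_insert_of_notMem h]
    omega

lemma tog_mem {ι : Type} [Fintype ι] [DecidableEq ι] (o k : ι) (hk : k ≠ o) (I : Finset ι)
    (hI : I ∈ (KK o).erase {k}) : tog k I ∈ (KK o).erase {k} := by
  simp only [KK, Finset.mem_erase, Finset.mem_filter, Finset.mem_univ, true_and] at hI ⊢
  obtain ⟨h1, h2, h3⟩ := hI
  by_cases h : k ∈ I
  · simp only [tog, h, if_true]
    refine ⟨?_, ?_, ?_⟩
    · intro e
      have : k ∈ I.erase k := by rw [e]; simp
      simp at this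
    · simp [h2]
    · rw [Finset.nonempty_iff_ne_empty]
      intro e
      rcases (Finset.erase_eq_empty_iff _ _).1 e with h' | h'
      · exact h3.ne_empty h'
      · exact h1 h'
  · simp only [tog, h, if_false]
    refine ⟨?_, ?_, by simp⟩
    · intro e
      have : (insert k I).erase k = ∅ := by rw [e]; simp
      rw [Finset.erase_insert h] at this
      exact h3.ne_empty this
    · simp [h2, Ne.symm hk]

open Classical in
lemma diff_k {ι : Type} [Fintype ι] [DecidableEq ι] (n : ℕ) (o k : ι) (hk : k ≠ o)
    (v : ι → Fin d → ℝ)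
    (p : ℕ → ℕ → Finset ι → Fin d → ℝ) (C : Conf n o v p)
    (T : (Fin d → ℝ) ⧸ (Submodule.span ℝ {v k})) :
    ((qq p 0 '' (JJ n o : Set (ℕ × Finset ι))) ∩ fiber _ T).ncard +
      (if (Submodule.Quotient.mk (p 0 0 ∅) : (Fin d → ℝ) ⧸ (Submodule.span ℝ {v k})) = T
        then 1 else 0) =
    ((qq p 1 '' (JJ n o : Set (ℕ × Finset ι))) ∩ fiber _ T).ncard +
      (if (Submodule.Quotient.mk (p 0 n ∅) : (Fin d → ℝ) ⧸ (Submodule.span ℝ {v k})) = T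
        then 1 else 0) := by
  rw [count n o v p C, count n o v p C]
  have hkK : ({k} : Finset ι) ∈ KK o := by simp [KK, Ne.symm hk]
  have hok : o ∉ ({k} : Finset ι) := by simpa using Ne.symm hk
  have e1 : ∀ j, (Submodule.Quotient.mk (qq p 0 (j, {k})) :
      (Fin d → ℝ) ⧸ (Submodule.span ℝ {v k})) = Submodule.Quotient.mk (p 0 (j + 1) ∅) := by
    intro j
    rw [Submodule.Quotient.eq]
    simp only [qq, Finset.card_singleton, add_zero, Nat.mod_self, Nat.reduceAdd, Nat.one_mod]
    exact C.lk' k hk j _ {k} 0 ∅ hok (by simp) (by simp) (by simp)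
  have e2 : ∀ j, (Submodule.Quotient.mk (qq p 1 (j, {k})) :
      (Fin d → ℝ) ⧸ (Submodule.span ℝ {v k})) = Submodule.Quotient.mk (p 0 j ∅) := by
    intro j
    rw [Submodule.Quotient.eq]
    simp only [qq, Finset.card_singleton, add_zero, Nat.mod_self, Nat.reduceAdd, Nat.one_mod]
    exact C.lk' k hk j _ {k} 0 ∅ hok (by simp) (by simp) (by simp)
  simp_rw [← Finset.add_sum_erase _ _ hkK, Finset.sum_add_distrib, e1, e2]
  have hrest : ∀ j, ∑ I ∈ (KK o).erase {k}, (if (Submodule.Quotient.mk (qq p 0 (j, I)) :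
      (Fin d → ℝ) ⧸ (Submodule.span ℝ {v k})) = T then 1 else 0) =
      ∑ I ∈ (KK o).erase {k}, (if (Submodule.Quotient.mk (qq p 1 (j, I)) :
      (Fin d → ℝ) ⧸ (Submodule.span ℝ {v k})) = T then 1 else 0) := by
    intro j
    refine Finset.sum_nbij' (tog k) (tog k) (fun I hI => tog_mem o k hk I hI)
      (fun I hI => tog_mem o k hk I hI) (fun I _ => tog_tog k I) (fun I _ => tog_tog k I) ?_
    intro I hI
    have hI' := tog_mem o k hk I hI
    simp only [KK, Finset.mem_erase, Finset.mem_filter] at hI hI'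
    have : (Submodule.Quotient.mk (qq p 0 (j, I)) :
        (Fin d → ℝ) ⧸ (Submodule.span ℝ {v k})) = Submodule.Quotient.mk (qq p 1 (j, tog k I)) := by
      rw [Submodule.Quotient.eq]
      unfold qq
      simp only [tog_card, add_zero]
      exact C.lk' k hk _ _ _ _ _ hI.2.2.1 hI'.2.2.1 (tog_erase k I).symm (Or.inl rfl)
    rw [this]
  simp_rw [hrest]
  have htel := Finset.sum_range_succ (fun j => if (Submodule.Quotient.mk (p 0 j ∅) :
      (Fin d → ℝ) ⧸ (Submodule.span ℝ {v k})) = T then 1 else 0) n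
  rw [Finset.sum_range_succ'] at htel
  omega

open Classical in
lemma sum_k {ι : Type} [Fintype ι] [DecidableEq ι] (n : ℕ) (hn : 0 < n) (o k : ι) (hk : k ≠ o)
    (v : ι → Fin d → ℝ)
    (p : ℕ → ℕ → Finset ι → Fin d → ℝ) (C : Conf n o v p) :
    ∑ᶠ T : (Fin d → ℝ) ⧸ (Submodule.span ℝ {v k}),
    ((((qq p 0 '' (JJ n o : Set (ℕ × Finset ι))) ∩ fiber _ T).ncard : ℤ) -
    (((qq p 1 '' (JJ n o : Set (ℕ × Finset ι))) ∩ fiber _ T).ncard : ℤ)).natAbs = 2 := by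
  set g0 := (Submodule.Quotient.mk (p 0 0 ∅) : (Fin d → ℝ) ⧸ (Submodule.span ℝ {v k})) with hg0
  set g1 := (Submodule.Quotient.mk (p 0 n ∅) : (Fin d → ℝ) ⧸ (Submodule.span ℝ {v k})) with hg1
  have hne : g0 ≠ g1 := by
    intro h
    rw [hg0, hg1, Submodule.Quotient.eq] at h
    have := C.lk k hk 0 0 ∅ 0 n ∅ (by omega) (by omega) (by simp) (by omega) (by omega)
      (by simp) h
    omega
  have hT : ∀ T : (Fin d → ℝ) ⧸ (Submodule.span ℝ {v k}),
    ((((qq p 0 '' (JJ n o : Set (ℕ × Finset ι))) ∩ fiber _ T).ncard : ℤ) -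
    (((qq p 1 '' (JJ n o : Set (ℕ × Finset ι))) ∩ fiber _ T).ncard : ℤ)).natAbs =
      (if g0 = T then 1 else 0) + (if g1 = T then 1 else 0) := by
    intro T
    have h := diff_k n o k hk v p C T
    rw [← hg0, ← hg1] at h
    by_cases h0 : g0 = T
    · have h1 : g1 ≠ T := fun h => hne (h0.trans h.symm)
      simp only [h0, h1, if_true, if_false] at h ⊢
      omega
    · by_cases h1 : g1 = T
      · simp only [h0, h1, if_true, if_false] at h ⊢
        omega
      · simp only [h0, h1, if_false] at h ⊢
        omega
  simp_rw [hT]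
  rw [finsum_eq_sum_of_support_subset (s := {g0, g1})]
  · rw [Finset.sum_pair hne]
    simp [hne, Ne.symm hne]
  · intro T hT'
    simp only [Function.mem_support] at hT'
    by_contra hcon
    simp only [Finset.coe_insert, Finset.coe_singleton, Set.mem_insert_iff,
      Set.mem_singleton_iff, not_or] at hcon
    apply hT'
    simp [Ne.symm hcon.1, Ne.symm hcon.2]

/-- Common core of both parts. -/
lemma core (m : ℕ) (hm : 3 ≤ m) (α : ℕ)
    (𝒮 : Set (Submodule ℝ (Fin d → ℝ))) (hfin : 𝒮.Finite) (hcard : 𝒮.ncard = m)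
    (v : 𝒮 → Fin d → ℝ) (hv0 : ∀ S, v S ≠ 0)
    (hv : ∀ S : 𝒮, (S : Submodule ℝ (Fin d → ℝ)) = Submodule.span ℝ {v S}) :
    ∃ F₁ F₂ : Set (Fin d → ℝ), F₁.Finite ∧ F₂.Finite ∧
        (∀ F' : Set (Fin d → ℝ), F'.Finite → TomEq 𝒮 F' F₁ → F' = F₁) ∧
        (∀ F' : Set (Fin d → ℝ), F'.Finite → TomEq 𝒮 F' F₂ → F' = F₂) ∧
        xrayDiff 𝒮 F₁ F₂ = 2 * (m - 1) ∧
        F₁.ncard = F₂.ncard ∧ α ≤ F₁.ncard ∧ F₁ ∩ F₂ = ∅ ∧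
        (∀ x ∈ F₁ ∪ F₂, ∃ (N : Type) (_ : Fintype N) (t : N → ℤ) (c : N → 𝒮) (A : Finset N),
          x = Pt t c v A) := by
  classical
  have : Fintype 𝒮 := hfin.fintype
  have hc : Fintype.card 𝒮 = m := by rw [← hcard, Set.ncard_eq_toFinset_card', Set.toFinset_card]
  have hlin : ∀ i k : 𝒮, i ≠ k → v i ∉ Submodule.span ℝ {v k} := by
    intro i k hik hmem
    apply hik
    apply Subtype.ext
    rw [hv i, hv k]
    obtain ⟨l, hl⟩ := Submodule.mem_span_singleton.1 hmem
    have hl0 : l ≠ 0 := by rintro rfl; exact hv0 i (by rw [← hl, zero_smul])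
    rw [← hl]
    exact Submodule.span_singleton_smul_eq (IsUnit.mk0 l hl0) (v k)
  have hpos : 0 < Fintype.card 𝒮 := by omega
  obtain ⟨o⟩ := Fintype.card_pos_iff.1 hpos
  obtain ⟨k, hk⟩ : ∃ k : 𝒮, k ≠ o := by
    have : Nontrivial 𝒮 := Fintype.one_lt_card_iff_nontrivial.1 (by omega)
    exact exists_ne o
  obtain ⟨t, C⟩ := exists_conf (by omega : 3 ≤ Fintype.card 𝒮) (α + 1) o v hlin
  set p : ℕ → ℕ → Finset 𝒮 → Fin d → ℝ := fun j a I => Pt t Prod.snd v (AA (α + 1) o j a I)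
    with hp
  have hX : ∀ e, ∀ x ∈ qq p e '' (JJ (α + 1) o : Set (ℕ × Finset 𝒮)),
      ∃ j a I, Val (α + 1) o j a I ∧ x = p j a I := by
    rintro e x ⟨y, hy, rfl⟩
    exact ⟨_, _, _, val_of_mem _ o e y hy, rfl⟩
  have hfinite : ∀ e, (qq p e '' (JJ (α + 1) o : Set (ℕ × Finset 𝒮))).Finite :=
    fun e => (Finset.finite_toSet _).image _
  have hU : ∀ e, ∀ F' : Set (Fin d → ℝ), F'.Finite →
      TomEq 𝒮 F' (qq p e '' (JJ (α + 1) o : Set (ℕ × Finset 𝒮))) →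
      F' = qq p e '' (JJ (α + 1) o : Set (ℕ × Finset 𝒮)) := by
    intro e F' hF' hT
    refine uniq (α + 1) o v p C F' _ hF' (hfinite e) (hX e) ?_
    intro k
    have := hT k k.2
    rwa [hv k] at this
  have hcardq : ∀ e, (qq p e '' (JJ (α + 1) o : Set (ℕ × Finset 𝒮))).ncard = (JJ (α + 1) o).card := by
    intro e
    rw [Set.InjOn.ncard_image (qq_inj _ o v p C e), Set.ncard_coe_finset]
  refine ⟨_, _, hfinite 0, hfinite 1, hU 0, hU 1, ?_, ?_, ?_, ?_, ?_⟩
  · unfold xrayDiff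
    rw [← finsum_set_coe_eq_finsum_mem, finsum_eq_sum_of_fintype]
    have hterm : ∀ S : 𝒮, (∑ᶠ T : (Fin d → ℝ) ⧸ (S : Submodule ℝ (Fin d → ℝ)),
        ((((qq p 0 '' (JJ (α + 1) o : Set (ℕ × Finset 𝒮))) ∩ fiber _ T).ncard : ℤ) -
        (((qq p 1 '' (JJ (α + 1) o : Set (ℕ × Finset 𝒮))) ∩ fiber _ T).ncard : ℤ)).natAbs) =
        if S = o then 0 else 2 := by
      intro S
      rw [hv S]
      split_ifs with hS
      · subst hS
        simp_rw [diff_o _ S v p C]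
        simp
      · exact sum_k (α + 1) (by omega) o S hS v p C
    rw [Finset.sum_congr rfl (fun S _ => hterm S), ← Finset.add_sum_erase _ _ (Finset.mem_univ o),
      Finset.sum_congr rfl (fun S hS => if_neg (Finset.ne_of_mem_erase hS))]
    simp [hc, Finset.card_erase_of_mem]
    omega
  · rw [hcardq, hcardq]
  · rw [hcardq, JJ, Finset.card_product, Finset.card_range]
    have : 0 < (KK o).card := Finset.card_pos.2 ⟨{k}, by simp [KK, Ne.symm hk]⟩
    nlinarith
  · rw [Set.eq_empty_iff_forall_notMem]
    rintro x ⟨⟨y, hy, rfl⟩, ⟨z, hz, hzy⟩⟩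
    exact qq_ne _ o k hk v p C y z hy hz hzy.symm
  · rintro x (hx | hx)
    · obtain ⟨j, a, I, -, rfl⟩ := hX 0 x hx
      exact ⟨_, inferInstance, t, Prod.snd, _, rfl⟩
    · obtain ⟨j, a, I, -, rfl⟩ := hX 1 x hx
      exact ⟨_, inferInstance, t, Prod.snd, _, rfl⟩

lemma embed_inj : Function.Injective (embed : (Fin d → ℤ) → Fin d → ℝ) := by
  intro x y h
  ext i
  have := congrFun h i
  simpa [embed] using this

lemma Pt_embed {N ι : Type} (t : N → ℤ) (c : N → ι) (u : ι → Fin d → ℤ) (A : Finset N) :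
    Pt t c (fun i => embed (u i)) A = embed (∑ y ∈ A, t y • u (c y)) := by
  ext i
  simp [Pt, embed, Finset.sum_apply]

end Instab

open Instab in
theorem instability_three_or_more_directions
    (d m : ℕ) (hm : 3 ≤ m) (α : ℕ)
    (𝒮 : Set (Submodule ℝ (Fin d → ℝ))) (hfin : 𝒮.Finite) (hcard : 𝒮.ncard = m) :
    ((∀ S ∈ 𝒮, Module.finrank ℝ S = 1) →
      ∃ F₁ F₂ : Set (Fin d → ℝ), F₁.Finite ∧ F₂.Finite ∧
        (∀ F' : Set (Fin d → ℝ), F'.Finite → TomEq 𝒮 F' F₁ → F' = F₁) ∧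
        (∀ F' : Set (Fin d → ℝ), F'.Finite → TomEq 𝒮 F' F₂ → F' = F₂) ∧
        xrayDiff 𝒮 F₁ F₂ = 2 * (m - 1) ∧
        F₁.ncard = F₂.ncard ∧ α ≤ F₁.ncard ∧ F₁ ∩ F₂ = ∅) ∧
    ((∀ S ∈ 𝒮, IsLatticeLine S) →
      ∃ F₁ F₂ : Finset (Fin d → ℤ),
        (∀ F' : Finset (Fin d → ℤ), TomEq 𝒮 (embed '' ↑F') (embed '' ↑F₁) → F' = F₁) ∧
        (∀ F' : Finset (Fin d → ℤ), TomEq 𝒮 (embed '' ↑F') (embed '' ↑F₂) → F' = F₂) ∧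
        xrayDiff 𝒮 (embed '' ↑F₁) (embed '' ↑F₂) = 2 * (m - 1) ∧
        F₁.card = F₂.card ∧ α ≤ F₁.card ∧ F₁ ∩ F₂ = ∅) := by
  constructor
  · intro h
    have hex : ∀ S : 𝒮, ∃ v : Fin d → ℝ, v ≠ 0 ∧
        (S : Submodule ℝ (Fin d → ℝ)) = Submodule.span ℝ {v} := by
      intro S
      obtain ⟨w, hw0, hw⟩ := finrank_eq_one_iff'.1 (h S S.2)
      refine ⟨w, fun e => hw0 (Subtype.ext e), ?_⟩
      apply le_antisymm
      · intro x hx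
        obtain ⟨c, hc⟩ := hw ⟨x, hx⟩
        exact Submodule.mem_span_singleton.2 ⟨c, congrArg Subtype.val hc⟩
      · rw [Submodule.span_singleton_le_iff_mem]
        exact w.2
    choose v hv0 hv using hex
    obtain ⟨F₁, F₂, h1, h2, h3, h4, h5, h6, h7, h8, -⟩ :=
      core m hm α 𝒮 hfin hcard v hv0 hv
    exact ⟨F₁, F₂, h1, h2, h3, h4, h5, h6, h7, h8⟩
  · intro h
    have hex : ∀ S : 𝒮, ∃ u : Fin d → ℤ, u ≠ 0 ∧
        (S : Submodule ℝ (Fin d → ℝ)) = Submodule.span ℝ {embed u} := fun S => h S S.2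
    choose u hu0 hu using hex
    obtain ⟨F₁, F₂, h1, h2, h3, h4, h5, h6, h7, h8, h9⟩ :=
      core m hm α 𝒮 hfin hcard (fun S => embed (u S))
        (fun S e => hu0 S (embed_inj (by rw [e]; ext i; simp [embed]))) hu
    have hr : ∀ x ∈ F₁ ∪ F₂, x ∈ Set.range (embed : (Fin d → ℤ) → Fin d → ℝ) := by
      intro x hx
      obtain ⟨N, _, t, c, A, rfl⟩ := h9 x hx
      exact ⟨_, (Pt_embed t c u A).symm⟩
    have hG : ∀ F : Set (Fin d → ℝ), F.Finite → F ⊆ F₁ ∪ F₂ →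
        ∃ G : Finset (Fin d → ℤ), embed '' (G : Set (Fin d → ℤ)) = F := by
      intro F hF hsub
      have hpre : (embed ⁻¹' F : Set (Fin d → ℤ)).Finite := hF.preimage embed_inj.injOn
      refine ⟨hpre.toFinset, ?_⟩
      rw [Set.Finite.coe_toFinset, Set.image_preimage_eq_iff]
      exact fun x hx => hr x (hsub hx)
    obtain ⟨G₁, rfl⟩ := hG F₁ h1 Set.subset_union_left
    obtain ⟨G₂, rfl⟩ := hG F₂ h2 Set.subset_union_right
    have hn : ∀ G : Finset (Fin d → ℤ), (embed '' (G : Set (Fin d → ℤ))).ncard = G.card := by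
      intro G
      rw [Set.ncard_image_of_injective _ embed_inj, Set.ncard_coe_finset]
    rw [hn, hn] at h6
    rw [hn] at h7
    refine ⟨G₁, G₂, ?_, ?_, h5, h6, h7, ?_⟩
    · intro F' hT
      exact Finset.coe_injective
        (embed_inj.image_injective (h3 _ ((Finset.finite_toSet _).image _) hT))
    · intro F' hT
      exact Finset.coe_injective
        (embed_inj.image_injective (h4 _ ((Finset.finite_toSet _).image _) hT))
    · rw [Finset.eq_empty_iff_forall_notMem]
      intro x hx
      rw [Finset.mem_inter] at hx
      have : embed x ∈ (embed '' (G₁ : Set (Fin d → ℤ)) ∩ embed '' (G₂ : Set (Fin d → ℤ))) :=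
        ⟨⟨x, hx.1, rfl⟩, ⟨x, hx.2, rfl⟩⟩
      rw [h8] at this
      exact this
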